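/- Let s ≠ t be vertices and let F ⊆ E satisfy the capacity condition for (s,t), with 𝒞 its family of violated cuts. Let A, B ∈ 𝒞 properly intersect, let e₁ be the unique safe edge of δ_F(A) and e₂ the unique safe edge of δ_F(B). If there is an s-t path in (V,F) on which both e₁ and e₂ lie, then A ∩ B ∈ 𝒞 and A ∪ B ∈ 𝒞; moreover every safe edge of δ_F(A ∩ B) ∪ δ_F(A ∪ B) belongs to {e₁, e₂}. -/

import Mathlib

open scoped BigOperators

/-- An edge `e` crosses the vertex set `A` if exactly one of its endpoints lies in `A`. -/
def crosses {V E : Type*} (ends : E → Sym2 V) (A : Set V) (e : E) : Prop :=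
  ∃ u v : V, ends e = s(u, v) ∧ u ∈ A ∧ v ∉ A

/-- `cut ends F A` is `δ_F(A)`: the set of edges of `F` with exactly one endpoint in `A`. -/
def cut {V E : Type*} (ends : E → Sym2 V) (F : Set E) (A : Set V) : Set E :=
  {e | e ∈ F ∧ crosses ends A e}

/-- Two vertex sets properly intersect. -/
def properlyIntersect {V : Type*} (A B : Set V) : Prop :=
  (A ∩ B).Nonempty ∧ (A \ B).Nonempty ∧ (B \ A).Nonempty

/-- `F` satisfies the capacity condition for the pair `(s,t)`. -/
def capCond {V E : Type*} (ends : E → Sym2 V) (𝒮 𝒰 : Set E) (s t : V) (F : Set E) : Prop :=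
  ∀ A : Set V, s ∈ A → t ∉ A →
    4 ≤ 2 * (cut ends (F ∩ 𝒮) A).ncard + (cut ends (F ∩ 𝒰) A).ncard

/-- The family of violated cuts of `F` for the `(2,2)`-Flex-ST augmentation. -/
def violatedST {V E : Type*} (ends : E → Sym2 V) (𝒮 𝒰 : Set E) (s t : V) (F : Set E) :
    Set (Set V) :=
  {A | s ∈ A ∧ t ∉ A ∧ (cut ends (F ∩ 𝒮) A).ncard = 1 ∧ (cut ends (F ∩ 𝒰) A).ncard = 2}

/-- An `s`-`t` path in `(V, F)`: pairwise distinct vertices `v 0 = s, …, v k = t` together with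
pairwise distinct edges `es 0, …, es (k-1)` of `F`, where `es i` joins `v i` and `v (i+1)`. -/
def IsSTPath {V E : Type*} (ends : E → Sym2 V) (F : Set E) (s t : V) (k : ℕ)
    (v : Fin (k + 1) → V) (es : Fin k → E) : Prop :=
  Function.Injective v ∧ Function.Injective es ∧
  v 0 = s ∧ v (Fin.last k) = t ∧
  ∀ i : Fin k, es i ∈ F ∧ ends (es i) = s(v i.castSucc, v i.succ)

theorem crosses_or_of_crosses_inter {V E : Type*} {ends : E → Sym2 V} {A B : Set V} {e : E}
    (h : crosses ends (A ∩ B) e) : crosses ends A e ∨ crosses ends B e := by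
  obtain ⟨u, v, he, hu, hv⟩ := h
  by_cases hvA : v ∈ A
  · exact Or.inr ⟨u, v, he, hu.2, fun hvB => hv ⟨hvA, hvB⟩⟩
  · exact Or.inl ⟨u, v, he, hu.1, hvA⟩

theorem crosses_or_of_crosses_union {V E : Type*} {ends : E → Sym2 V} {A B : Set V} {e : E}
    (h : crosses ends (A ∪ B) e) : crosses ends A e ∨ crosses ends B e := by
  obtain ⟨u, v, he, hu, hv⟩ := h
  exact hu.imp (fun hu => ⟨u, v, he, hu, fun h => hv (Or.inl h)⟩)
    (fun hu => ⟨u, v, he, hu, fun h => hv (Or.inr h)⟩)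

theorem crosses_and_of_crosses_inter_of_crosses_union {V E : Type*} {ends : E → Sym2 V}
    {A B : Set V} {e : E} (hi : crosses ends (A ∩ B) e) (hu : crosses ends (A ∪ B) e) :
    crosses ends A e ∧ crosses ends B e := by
  obtain ⟨u, v, he, huI, -⟩ := hi
  obtain ⟨u', v', he', -, hv'⟩ := hu
  rw [he, Sym2.eq_iff] at he'
  rcases he' with ⟨rfl, rfl⟩ | ⟨rfl, rfl⟩
  · exact ⟨⟨u, v, he, huI.1, fun h => hv' (Or.inl h)⟩, ⟨u, v, he, huI.2, fun h => hv' (Or.inr h)⟩⟩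
  · exact absurd (Or.inl huI.1) hv'

theorem cut_inter_union_subset {V E : Type*} (ends : E → Sym2 V) (G : Set E) (A B : Set V) :
    cut ends G (A ∩ B) ∪ cut ends G (A ∪ B) ⊆ cut ends G A ∪ cut ends G B := by
  rintro e (⟨hG, h⟩ | ⟨hG, h⟩)
  · exact (crosses_or_of_crosses_inter h).imp (⟨hG, ·⟩) (⟨hG, ·⟩)
  · exact (crosses_or_of_crosses_union h).imp (⟨hG, ·⟩) (⟨hG, ·⟩)

/-- Submodularity of the cut function. -/
theorem ncard_cut_inter_add_ncard_cut_union_le {V E : Type*} [Finite E] (ends : E → Sym2 V)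
    (G : Set E) (A B : Set V) :
    (cut ends G (A ∩ B)).ncard + (cut ends G (A ∪ B)).ncard ≤
      (cut ends G A).ncard + (cut ends G B).ncard := by
  rw [← Set.ncard_union_add_ncard_inter (cut ends G (A ∩ B)),
    ← Set.ncard_union_add_ncard_inter (cut ends G A)]
  refine add_le_add (Set.ncard_le_ncard (cut_inter_union_subset ends G A B))
    (Set.ncard_le_ncard ?_)
  rintro e ⟨⟨hG, hi⟩, ⟨-, hu⟩⟩
  obtain ⟨hA, hB⟩ := crosses_and_of_crosses_inter_of_crosses_union hi hu
  exact ⟨⟨hG, hA⟩, ⟨hG, hB⟩⟩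

theorem crosses_mk_iff {V E : Type*} {ends : E → Sym2 V} {A : Set V} {e : E} {u v : V}
    (he : ends e = s(u, v)) : crosses ends A e ↔ ¬(u ∈ A ↔ v ∈ A) := by
  constructor
  · rintro ⟨u', v', he', hu, hv⟩
    rw [he, Sym2.eq_iff] at he'
    rcases he' with ⟨rfl, rfl⟩ | ⟨rfl, rfl⟩ <;> tauto
  · intro h
    by_cases hu : u ∈ A
    · exact ⟨u, v, he, hu, by tauto⟩
    · exact ⟨v, u, he.trans Sym2.eq_swap, by tauto, hu⟩

theorem Fin.sum_succ_sub_castSucc {G : Type*} [AddCommGroup G] {k : ℕ} (f : Fin (k + 1) → G) :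
    ∑ i : Fin k, (f i.succ - f i.castSucc) = f (Fin.last k) - f 0 := by
  rw [Finset.sum_sub_distrib, sub_eq_sub_iff_add_eq_add, add_comm, ← Fin.sum_univ_succ,
    Fin.sum_univ_castSucc, add_comm]

/-- A path using both edges of a two-edge cut ends on the side on which it starts. -/
theorem IsSTPath.end_mem_of_cut_eq_pair {V E : Type*} {ends : E → Sym2 V} {F : Set E} {s t : V}
    {k : ℕ} {v : Fin (k + 1) → V} {es : Fin k → E} (hp : IsSTPath ends F s t k v es)
    {X : Set V} (hs : s ∈ X) {i j : Fin k} (hij : i ≠ j)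
    (hX : cut ends F X = {es i, es j}) : t ∈ X := by
  classical
  obtain ⟨-, hinj, h0, hl, hedge⟩ := hp
  let f : Fin (k + 1) → ZMod 2 := fun n => if v n ∈ X then 1 else 0
  have hstep : ∀ m : Fin k, f m.succ - f m.castSucc =
      if m ∈ ({i, j} : Finset (Fin k)) then 1 else 0 := by
    intro m
    have hm : m ∈ ({i, j} : Finset (Fin k)) ↔ ¬(v m.castSucc ∈ X ↔ v m.succ ∈ X) := by
      rw [← crosses_mk_iff (hedge m).2]
      have h : es m ∈ cut ends F X ↔ es m ∈ ({es i, es j} : Set E) := by rw [hX]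
      simp only [Set.mem_insert_iff, Set.mem_singleton_iff, hinj.eq_iff] at h
      simp only [Finset.mem_insert, Finset.mem_singleton]
      rw [← h]
      exact ⟨fun h => h.2, fun h => ⟨(hedge m).1, h⟩⟩
    simp only [hm, f]
    by_cases h1 : v m.castSucc ∈ X <;> by_cases h2 : v m.succ ∈ X <;> simp [h1, h2]
  have hsum := Fin.sum_succ_sub_castSucc f
  rw [Finset.sum_congr rfl fun m _ => hstep m, Finset.sum_ite_mem, Finset.univ_inter,
    Finset.sum_pair hij] at hsum
  by_contra ht
  simp only [f, h0, hl, hs, ht, if_true, if_false] at hsum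
  exact absurd hsum (by decide)

theorem cut_eq_union_of_union_eq_univ {V E : Type*} (ends : E → Sym2 V) {𝒮 𝒰 : Set E}
    (hpart : 𝒮 ∪ 𝒰 = Set.univ) (F : Set E) (X : Set V) :
    cut ends F X = cut ends (F ∩ 𝒮) X ∪ cut ends (F ∩ 𝒰) X := by
  ext e
  have he : e ∈ 𝒮 ∪ 𝒰 := hpart ▸ Set.mem_univ e
  simp only [cut, Set.mem_union, Set.mem_inter_iff, Set.mem_ofPred_eq] at he ⊢
  tauto

/-- A cut whose only edges are two safe edges taken from `{e₁, e₂}` cannot separate the ends of a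
path through `e₁` and `e₂`. -/
theorem IsSTPath.end_mem_of_ncard_cut {V E : Type*} [Finite E] {ends : E → Sym2 V}
    {𝒮 𝒰 F : Set E} (hpart : 𝒮 ∪ 𝒰 = Set.univ) {s t : V} {k : ℕ} {v : Fin (k + 1) → V}
    {es : Fin k → E} (hp : IsSTPath ends F s t k v es) {X : Set V} (hs : s ∈ X) {i j : Fin k}
    (hsub : cut ends (F ∩ 𝒮) X ⊆ {es i, es j}) (hS : (cut ends (F ∩ 𝒮) X).ncard = 2)
    (hU : (cut ends (F ∩ 𝒰) X).ncard = 0) : t ∈ X := by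
  have hij : i ≠ j := by
    rintro rfl
    have := Set.ncard_le_ncard hsub
    simp [hS] at this
  refine hp.end_mem_of_cut_eq_pair hs hij ?_
  rw [cut_eq_union_of_union_eq_univ ends hpart, (Set.ncard_eq_zero).1 hU, Set.union_empty]
  exact Set.eq_of_subset_of_ncard_le hsub
    (hS ▸ (Set.ncard_pair (hp.2.1.ne hij)).le)

theorem stmt4 {V E : Type*} [Fintype V] [Fintype E]
    (ends : E → Sym2 V) (𝒮 𝒰 : Set E)
    (hpart : 𝒮 ∪ 𝒰 = Set.univ) (hdisj : Disjoint 𝒮 𝒰)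
    (s t : V) (hst : s ≠ t)
    (F : Set E) (hF : capCond ends 𝒮 𝒰 s t F)
    (A B : Set V)
    (hA : A ∈ violatedST ends 𝒮 𝒰 s t F) (hB : B ∈ violatedST ends 𝒮 𝒰 s t F)
    (hAB : properlyIntersect A B)
    (e₁ e₂ : E)
    (he₁ : cut ends (F ∩ 𝒮) A = {e₁}) (he₂ : cut ends (F ∩ 𝒮) B = {e₂})
    (hpath : ∃ (k : ℕ) (v : Fin (k + 1) → V) (es : Fin k → E),
      IsSTPath ends F s t k v es ∧ (∃ i, es i = e₁) ∧ (∃ i, es i = e₂)) :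
    A ∩ B ∈ violatedST ends 𝒮 𝒰 s t F ∧ A ∪ B ∈ violatedST ends 𝒮 𝒰 s t F ∧
    ∀ e ∈ 𝒮, e ∈ cut ends F (A ∩ B) ∪ cut ends F (A ∪ B) → e = e₁ ∨ e = e₂ := by
  obtain ⟨hsA, htA, hSA, hUA⟩ := hA
  obtain ⟨hsB, htB, hSB, hUB⟩ := hB
  obtain ⟨k, v, es, hp, ⟨i, rfl⟩, ⟨j, rfl⟩⟩ := hpath
  have hsI : s ∈ A ∩ B := ⟨hsA, hsB⟩
  have hsU : s ∈ A ∪ B := Or.inl hsA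
  have htI : t ∉ A ∩ B := fun h => htA h.1
  have htU : t ∉ A ∪ B := fun h => h.elim htA htB
  have hS := ncard_cut_inter_add_ncard_cut_union_le ends (F ∩ 𝒮) A B
  have hU := ncard_cut_inter_add_ncard_cut_union_le ends (F ∩ 𝒰) A B
  have hcI := hF _ hsI htI
  have hcU := hF _ hsU htU
  have hsub := cut_inter_union_subset ends (F ∩ 𝒮) A B
  rw [he₁, he₂, Set.singleton_union] at hsub
  have hI : ¬((cut ends (F ∩ 𝒮) (A ∩ B)).ncard = 2 ∧ (cut ends (F ∩ 𝒰) (A ∩ B)).ncard = 0) :=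
    fun h => htI (hp.end_mem_of_ncard_cut hpart hsI (Set.subset_union_left.trans hsub) h.1 h.2)
  have hJ : ¬((cut ends (F ∩ 𝒮) (A ∪ B)).ncard = 2 ∧ (cut ends (F ∩ 𝒰) (A ∪ B)).ncard = 0) :=
    fun h => htU (hp.end_mem_of_ncard_cut hpart hsU (Set.subset_union_right.trans hsub) h.1 h.2)
  refine ⟨⟨hsI, htI, by omega, by omega⟩, ⟨hsU, htU, by omega, by omega⟩, fun e he h => ?_⟩
  exact hsub (h.imp (fun h => ⟨⟨h.1, he⟩, h.2⟩) (fun h => ⟨⟨h.1, he⟩, h.2⟩))
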